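/- Let T be a finite tree with root s, nonnegative real edge costs, and a budget B ≥ 0. The maximum number of distinct vertices visited by a walk from s of cost at most B equals the maximum of |S| over all vertex sets S such that s ∈ S, S is the vertex set of a subtree of T (i.e., S induces a connected subgraph of T), and 2·w(S) − max_{v ∈ S} d(s, v) ≤ B. -/

import Mathlib

/-- The cost of a walk in a graph with edge costs `c`: the sum of the costs of the
traversed edges, counted with multiplicity. -/
noncomputable def walkCost {V : Type*} {G : SimpleGraph V} (c : Sym2 V → ℝ)
    {u v : V} (p : G.Walk u v) : ℝ :=
  (p.edges.map c).sum

/-- The tree metric induced by the edge costs `c`: the minimum cost of a walk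
between two vertices. -/
noncomputable def treeDist {V : Type*} (G : SimpleGraph V) (c : Sym2 V → ℝ)
    (u v : V) : ℝ :=
  sInf {x | ∃ p : G.Walk u v, x = walkCost c p}

/-- The total edge cost `w(S)` of the minimal subtree `T_S` containing `S`: the
minimum total cost of a set of edges of `G` connecting `s` to every vertex of `S`. -/
noncomputable def steinerWeight {V : Type*} (G : SimpleGraph V) (c : Sym2 V → ℝ)
    (s : V) (S : Finset V) : ℝ :=
  sInf {x | ∃ E' : Finset (Sym2 V), ↑E' ⊆ G.edgeSet ∧
    (∀ v ∈ S, (SimpleGraph.fromEdgeSet (↑E' : Set (Sym2 V))).Reachable s v) ∧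
    x = ∑ e ∈ E', c e}

/-- A bridge is traversed an even number of times by a walk whose ends lie on the same side of
it, and an odd number of times otherwise. -/
theorem even_count_edges_iff {V : Type*} [DecidableEq V] {G : SimpleGraph V} {a b : V}
    (hb : ¬ (G.deleteEdges {s(a, b)}).Reachable a b) {u v : V} (p : G.Walk u v) :
    Even (p.edges.count s(a, b)) ↔
      ((G.deleteEdges {s(a, b)}).Reachable a u ↔ (G.deleteEdges {s(a, b)}).Reachable a v) := by
  induction p with
  | nil => simp
  | @cons x y z h p ih =>
    rw [SimpleGraph.Walk.edges_cons, List.count_cons]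
    by_cases he : s(x, y) = s(a, b)
    · have hxy : (G.deleteEdges {s(a, b)}).Reachable a x ↔
          ¬ (G.deleteEdges {s(a, b)}).Reachable a y := by
        rcases Sym2.eq_iff.1 he with ⟨rfl, rfl⟩ | ⟨rfl, rfl⟩
        · simp [hb]
        · simp [hb]
      simp only [he, beq_self_eq_true, if_true, Nat.even_add_one, ih, hxy]
      tauto
    · have hadj : (G.deleteEdges {s(a, b)}).Adj x y := by
        simp only [SimpleGraph.deleteEdges_adj, Set.mem_singleton_iff]
        exact ⟨h, he⟩
      have hxy : (G.deleteEdges {s(a, b)}).Reachable a x ↔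
          (G.deleteEdges {s(a, b)}).Reachable a y :=
        ⟨fun r => r.trans hadj.reachable, fun r => r.trans hadj.symm.reachable⟩
      simp [he, ih, hxy]

theorem two_le_count_edges_of_closed {V : Type*} [DecidableEq V] {G : SimpleGraph V}
    (hG : G.IsAcyclic) {u : V} (p : G.Walk u u) {e : Sym2 V} (he : e ∈ p.edges) :
    2 ≤ p.edges.count e := by
  induction e with
  | _ a b =>
    have hbr := SimpleGraph.isAcyclic_iff_forall_isBridge.1 hG (p.edges_subset_edgeSet he)
    have hev := (even_count_edges_iff (SimpleGraph.isBridge_iff.1 hbr) p).2 Iff.rfl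
    have hpos := List.count_pos_iff.2 he
    obtain ⟨k, hk⟩ := hev
    omega

theorem two_mul_sum_edges_le_walkCost_add {V : Type*} [DecidableEq V] {G : SimpleGraph V}
    (hG : G.IsAcyclic) {c : Sym2 V → ℝ} (hc : ∀ e, 0 ≤ c e) {u v : V} (p q : G.Walk u v) :
    2 * ∑ e ∈ p.edges.toFinset, c e ≤ walkCost c p + walkCost c q := by
  have hcost : walkCost c p + walkCost c q = walkCost c (p.append q.reverse) := by
    simp [walkCost, SimpleGraph.Walk.edges_append, SimpleGraph.Walk.edges_reverse]
  rw [hcost, walkCost, Finset.sum_list_map_count, Finset.mul_sum]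
  calc ∑ e ∈ p.edges.toFinset, 2 * c e
      ≤ ∑ e ∈ (p.append q.reverse).edges.toFinset, 2 * c e := by
        refine Finset.sum_le_sum_of_subset_of_nonneg ?_ fun e _ _ => by linarith [hc e]
        intro e he
        simp only [List.mem_toFinset, SimpleGraph.Walk.edges_append, List.mem_append] at he ⊢
        exact Or.inl he
    _ ≤ _ := by
        refine Finset.sum_le_sum fun e he => ?_
        rw [nsmul_eq_mul]
        refine mul_le_mul_of_nonneg_right ?_ (hc e)
        exact_mod_cast two_le_count_edges_of_closed hG _ (List.mem_toFinset.1 he)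

theorem walkCost_nonneg {V : Type*} {G : SimpleGraph V} {c : Sym2 V → ℝ}
    (hc : ∀ e, 0 ≤ c e) {u v : V} (p : G.Walk u v) : 0 ≤ walkCost c p :=
  List.sum_nonneg fun x hx => by
    obtain ⟨e, -, rfl⟩ := List.mem_map.1 hx
    exact hc e

theorem treeDist_le_walkCost {V : Type*} {G : SimpleGraph V} {c : Sym2 V → ℝ}
    (hc : ∀ e, 0 ≤ c e) {u v : V} (p : G.Walk u v) : treeDist G c u v ≤ walkCost c p := by
  refine csInf_le ⟨0, ?_⟩ ⟨p, rfl⟩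
  rintro _ ⟨q, rfl⟩
  exact walkCost_nonneg hc q

theorem steinerWeight_le_sum {V : Type*} {G : SimpleGraph V} {c : Sym2 V → ℝ}
    (hc : ∀ e, 0 ≤ c e) {s : V} {S : Finset V} {E' : Finset (Sym2 V)}
    (hE : (E' : Set (Sym2 V)) ⊆ G.edgeSet)
    (hr : ∀ v ∈ S, (SimpleGraph.fromEdgeSet (E' : Set (Sym2 V))).Reachable s v) :
    steinerWeight G c s S ≤ ∑ e ∈ E', c e := by
  refine csInf_le ⟨0, ?_⟩ ⟨E', hE, hr, rfl⟩
  rintro _ ⟨F, -, -, rfl⟩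
  exact Finset.sum_nonneg fun e _ => hc e

theorem exists_steinerWeight_eq_sum {V : Type*} [Finite V] {G : SimpleGraph V}
    (hG : G.Connected) (c : Sym2 V → ℝ) (s : V) (S : Finset V) :
    ∃ E' : Finset (Sym2 V), (E' : Set (Sym2 V)) ⊆ G.edgeSet ∧
      (∀ v ∈ S, (SimpleGraph.fromEdgeSet (E' : Set (Sym2 V))).Reachable s v) ∧
      steinerWeight G c s S = ∑ e ∈ E', c e := by
  have : Fintype V := Fintype.ofFinite V
  refine Set.Nonempty.csInf_mem (s := {x | ∃ E' : Finset (Sym2 V), ↑E' ⊆ G.edgeSet ∧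
    (∀ v ∈ S, (SimpleGraph.fromEdgeSet (↑E' : Set (Sym2 V))).Reachable s v) ∧
    x = ∑ e ∈ E', c e}) ?_ ?_
  · refine ⟨_, (Set.toFinite G.edgeSet).toFinset, by simp, fun v _ => ?_, rfl⟩
    rw [Set.Finite.coe_toFinset, SimpleGraph.fromEdgeSet_edgeSet]
    exact hG.preconnected s v
  · refine (Set.finite_range fun E' : Finset (Sym2 V) => ∑ e ∈ E', c e).subset ?_
    rintro _ ⟨E', -, -, rfl⟩
    exact ⟨E', rfl⟩

/-- Every vertex of a walk is joined to its start by the edges of the walk. -/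
theorem reachable_fromEdgeSet_edges {V : Type*} {G : SimpleGraph V} {u v w : V}
    (p : G.Walk u v) (hw : w ∈ p.support) :
    (SimpleGraph.fromEdgeSet {e | e ∈ p.edges}).Reachable u w := by
  classical
  refine ⟨(p.takeUntil w hw).transfer _ fun e he => ?_⟩
  have hp := p.edges_takeUntil_subset_edges hw he
  rw [SimpleGraph.edgeSet_fromEdgeSet]
  exact ⟨hp, G.not_isDiag_of_mem_edgeSet (p.edges_subset_edgeSet hp)⟩

theorem two_mul_steinerWeight_support_sub_treeDist_le {V : Type*} [DecidableEq V]
    {G : SimpleGraph V} (hG : G.IsAcyclic) {c : Sym2 V → ℝ} (hc : ∀ e, 0 ≤ c e) {s v : V}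
    (p : G.Walk s v) :
    2 * steinerWeight G c s p.support.toFinset - treeDist G c s v ≤ walkCost c p := by
  have hw : steinerWeight G c s p.support.toFinset ≤ ∑ e ∈ p.edges.toFinset, c e := by
    refine steinerWeight_le_sum hc ?_ ?_
    · intro e he
      exact p.edges_subset_edgeSet (by simpa using he)
    · intro w hw
      rw [List.coe_toFinset]
      exact reachable_fromEdgeSet_edges p (List.mem_toFinset.1 hw)
  have hd : 2 * ∑ e ∈ p.edges.toFinset, c e - walkCost c p ≤ treeDist G c s v := by
    refine le_csInf ⟨_, p, rfl⟩ ?_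
    rintro _ ⟨q, rfl⟩
    linarith [two_mul_sum_edges_le_walkCost_add hG hc p q]
  linarith

/-- A walk that misses a vertex reachable from its start along `E'` can be extended by a
detour traversing one new edge of `E'` back and forth. -/
theorem exists_walk_detour {V : Type*} [DecidableEq V] {G : SimpleGraph V} {c : Sym2 V → ℝ}
    {E' : Finset (Sym2 V)} (hE : (E' : Set (Sym2 V)) ⊆ G.edgeSet) {s v w : V}
    (p : G.Walk s v) (hp : p.edges.toFinset ⊆ E')
    (hr : (SimpleGraph.fromEdgeSet (E' : Set (Sym2 V))).Reachable s w) (hw : w ∉ p.support) :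
    ∃ q : G.Walk s v, q.edges.toFinset ⊆ E' ∧
      p.support.toFinset.card < q.support.toFinset.card ∧
      2 * ∑ e ∈ q.edges.toFinset, c e - walkCost c q =
        2 * ∑ e ∈ p.edges.toFinset, c e - walkCost c p := by
  obtain ⟨r⟩ := hr
  obtain ⟨d, -, hx, hy⟩ := r.exists_boundary_dart {x | x ∈ p.support} p.start_mem_support hw
  have hmem : s(d.fst, d.snd) ∈ E' := by
    have := d.adj
    rw [SimpleGraph.fromEdgeSet_adj] at this
    exact this.1
  have hadj : G.Adj d.fst d.snd := hE hmem
  have hnew : s(d.fst, d.snd) ∉ p.edges := fun h => hy (p.snd_mem_support_of_mem_edges h)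
  generalize d.fst = x at *
  generalize d.snd = y at *
  let q : G.Walk s v := (p.takeUntil x hx).append
    (SimpleGraph.Walk.cons hadj (SimpleGraph.Walk.cons hadj.symm (p.dropUntil x hx)))
  have hspec := p.take_spec hx
  have hedges : p.edges = (p.takeUntil x hx).edges ++ (p.dropUntil x hx).edges := by
    rw [← SimpleGraph.Walk.edges_append, hspec]
  have hq : q.edges.toFinset = insert s(x, y) p.edges.toFinset := by
    ext e
    simp only [q, hedges, SimpleGraph.Walk.edges_append, SimpleGraph.Walk.edges_cons,
      List.mem_toFinset, List.mem_append, List.mem_cons, Finset.mem_insert, Sym2.eq_swap (a := y)]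
    tauto
  have hcost : walkCost c q = walkCost c p + 2 * c s(x, y) := by
    simp only [walkCost, hedges, q, SimpleGraph.Walk.edges_append, SimpleGraph.Walk.edges_cons,
      List.map_append, List.map_cons, List.sum_append, List.sum_cons, Sym2.eq_swap (a := y)]
    ring
  refine ⟨q, ?_, ?_, ?_⟩
  · rw [hq]
    exact Finset.insert_subset hmem hp
  · refine Finset.card_lt_card ((Finset.ssubset_iff_of_subset fun z hz => ?_).2
      ⟨y, ?_, by simpa using hy⟩)
    · rw [List.mem_toFinset, ← hspec, SimpleGraph.Walk.mem_support_append_iff] at hz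
      simp only [q, List.mem_toFinset, SimpleGraph.Walk.mem_support_append_iff,
        SimpleGraph.Walk.support_cons, List.mem_cons]
      tauto
    · simp [q, SimpleGraph.Walk.mem_support_append_iff]
  · rw [hcost, hq, Finset.sum_insert (by simpa using hnew)]
    ring

/-- The edges of `E'` can be toured by a walk from `s` to `v` which visits all vertices joined
to `s` by `E'` and saves the return trip from `v`. -/
theorem exists_walk_walkCost_add_treeDist_le {V : Type*} [Finite V]
    {G : SimpleGraph V} {c : Sym2 V → ℝ} (hc : ∀ e, 0 ≤ c e)
    {E' : Finset (Sym2 V)} (hE : (E' : Set (Sym2 V)) ⊆ G.edgeSet) {s v : V}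
    (hv : (SimpleGraph.fromEdgeSet (E' : Set (Sym2 V))).Reachable s v) :
    ∃ p : G.Walk s v,
      (∀ w, (SimpleGraph.fromEdgeSet (E' : Set (Sym2 V))).Reachable s w → w ∈ p.support) ∧
      walkCost c p + treeDist G c s v ≤ 2 * ∑ e ∈ E', c e := by
  classical
  have : Fintype V := Fintype.ofFinite V
  let P : Set (G.Walk s v) := {p | p.edges.toFinset ⊆ E' ∧
    walkCost c p + treeDist G c s v ≤ 2 * ∑ e ∈ p.edges.toFinset, c e}
  have hP : P.Nonempty := by
    obtain ⟨r, hr⟩ := hv.exists_isPath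
    have hrE : ∀ e ∈ r.edges, e ∈ E' := fun e he => by
      have := r.edges_subset_edgeSet he
      rw [SimpleGraph.edgeSet_fromEdgeSet] at this
      exact this.1
    let q : G.Walk s v := r.transfer G fun e he => hE (hrE e he)
    have hsum : walkCost c q = ∑ e ∈ q.edges.toFinset, c e := by
      rw [walkCost, List.sum_toFinset _ (by simpa [q] using hr.isTrail.edges_nodup)]
    refine ⟨q, fun e he => hrE e (by simpa [q] using he), ?_⟩
    linarith [treeDist_le_walkCost hc q]
  have hfin : ((fun p : G.Walk s v => p.support.toFinset.card) '' P).Finite :=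
    (Set.finite_Iic (Fintype.card V)).subset (by
      rintro _ ⟨p, -, rfl⟩
      exact Finset.card_le_univ _)
  obtain ⟨p, hpP, hmax⟩ := Set.Finite.exists_maximalFor'
    (fun p : G.Walk s v => p.support.toFinset.card) P hfin hP
  refine ⟨p, fun w hw => ?_, ?_⟩
  · by_contra hwp
    obtain ⟨q, hqE, hcard, hq⟩ := exists_walk_detour (c := c) hE p hpP.1 hw hwp
    exact absurd (hmax ⟨hqE, by linarith [hpP.2]⟩ hcard.le) (not_le.2 hcard)
  · have := Finset.sum_le_sum_of_subset_of_nonneg hpP.1 fun e _ _ => hc e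
    linarith [hpP.2]

/-- In a finite tree with root `s`, nonnegative edge costs and budget `B ≥ 0`, the
maximum number of distinct vertices visited by a walk from `s` of cost at most `B`
equals the maximum cardinality of a set `S ∋ s` inducing a subtree (a connected
subgraph) with `2·w(S) − max_{v ∈ S} d(s, v) ≤ B`. -/
theorem stmt17 {V : Type*} [Fintype V] [DecidableEq V] (G : SimpleGraph V)
    (hG : G.IsTree) (c : Sym2 V → ℝ) (hc : ∀ e, 0 ≤ c e) (s : V)
    (B : ℝ) (hB : 0 ≤ B) :
    sSup {k : ℕ | ∃ (v : V) (p : G.Walk s v),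
        walkCost c p ≤ B ∧ k = p.support.toFinset.card}
      = sSup {k : ℕ | ∃ (S : Finset V) (hs : s ∈ S),
          (G.induce (↑S : Set V)).Connected ∧
          2 * steinerWeight G c s S - S.sup' ⟨s, hs⟩ (fun v => treeDist G c s v) ≤ B ∧
          k = S.card} := by
  have hbdd₁ : BddAbove {k : ℕ | ∃ (v : V) (p : G.Walk s v),
      walkCost c p ≤ B ∧ k = p.support.toFinset.card} := by
    refine ⟨Fintype.card V, ?_⟩
    rintro _ ⟨v, p, -, rfl⟩
    exact Finset.card_le_univ _
  have hbdd₂ : BddAbove {k : ℕ | ∃ (S : Finset V) (hs : s ∈ S),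
      (G.induce (↑S : Set V)).Connected ∧
      2 * steinerWeight G c s S - S.sup' ⟨s, hs⟩ (fun v => treeDist G c s v) ≤ B ∧
      k = S.card} := by
    refine ⟨Fintype.card V, ?_⟩
    rintro _ ⟨S, -, -, -, rfl⟩
    exact Finset.card_le_univ _
  have hne : {k : ℕ | ∃ (v : V) (p : G.Walk s v),
      walkCost c p ≤ B ∧ k = p.support.toFinset.card}.Nonempty :=
    ⟨_, s, SimpleGraph.Walk.nil, by simpa [walkCost] using hB, rfl⟩
  have hsub : {k : ℕ | ∃ (v : V) (p : G.Walk s v),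
        walkCost c p ≤ B ∧ k = p.support.toFinset.card} ⊆
      {k : ℕ | ∃ (S : Finset V) (hs : s ∈ S),
        (G.induce (↑S : Set V)).Connected ∧
        2 * steinerWeight G c s S - S.sup' ⟨s, hs⟩ (fun v => treeDist G c s v) ≤ B ∧
        k = S.card} := by
    rintro _ ⟨v, p, hpB, rfl⟩
    refine ⟨p.support.toFinset, by simp, ?_, ?_, rfl⟩
    · rw [List.coe_toFinset]
      exact p.connected_induce_support
    · have hsup := Finset.le_sup' (fun v => treeDist G c s v)
        (List.mem_toFinset.2 p.end_mem_support)
      have := two_mul_steinerWeight_support_sub_treeDist_le hG.isAcyclic hc p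
      linarith
  refine le_antisymm (csSup_le_csSup hbdd₂ hne hsub) (csSup_le (hne.mono hsub) ?_)
  rintro _ ⟨S, hs, -, hSB, rfl⟩
  obtain ⟨E', hE, hr, hw⟩ := exists_steinerWeight_eq_sum hG.1 c s S
  obtain ⟨v, hvS, hv⟩ := Finset.exists_mem_eq_sup' ⟨s, hs⟩ (fun v => treeDist G c s v)
  obtain ⟨p, hp, hcost⟩ := exists_walk_walkCost_add_treeDist_le hc hE (hr v hvS)
  have hpB : walkCost c p ≤ B := by
    rw [hv] at hSB
    linarith
  refine le_trans (Finset.card_le_card fun w hwS => ?_) (le_csSup hbdd₁ ⟨v, p, hpB, rfl⟩)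
  exact List.mem_toFinset.2 (hp w (hr w hwS))
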